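/- Let 𝒫 be an imprecise probability tree and Q̄ an upper expectation tree that agree. Then for every situation s and every ℱ-measurable, bounded-below global variable f: Ω → ℝ̄, Ē_𝒫(f|s) = Ē_Q̄(f|s). -/

import Mathlib

open Filter MeasureTheory Topology
open scoped ENNReal

namespace UEPaper

variable {X : Type} [Fintype X] [Nonempty X] [DecidableEq X]

/-- The set of paths: infinite sequences of states (`ω i` is the `(i+1)`-th state). -/
abbrev Path (X : Type) := ℕ → X

/-- The prefix `ω^k` of length `k` of a path, as a list (a situation). -/
def prefixList (ω : Path X) (k : ℕ) : List X := (List.range k).map ω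

/-- The cylinder event `Γ(s)` of a situation `s`. -/
def cyl (s : List X) : Set (Path X) := {ω | prefixList ω s.length = s}

/-- `f` is `n`-measurable: it depends only on the first `n` states. -/
def NMeas (n : ℕ) (f : Path X → EReal) : Prop :=
  ∀ ω ω' : Path X, prefixList ω n = prefixList ω' n → f ω = f ω'

/-- A gamble: a bounded real-valued global variable. -/
def IsGamble (f : Path X → EReal) : Prop :=
  ∃ B : ℝ, ∀ ω, -(B : EReal) ≤ f ω ∧ f ω ≤ (B : EReal)

/-- A finitary gamble: an `n`-measurable gamble for some `n`. -/
def IsFinGamble (f : Path X → EReal) : Prop :=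
  (∃ n, NMeas n f) ∧ IsGamble f

/-- An upper expectation tree: a coherent upper expectation at each situation. -/
structure UpperExpTree (X : Type) [Fintype X] [Nonempty X] where
  Q : List X → (X → ℝ) → ℝ
  le_sup : ∀ (s : List X) (f : X → ℝ), Q s f ≤ ⨆ x, f x
  subadd : ∀ (s : List X) (f g : X → ℝ), Q s (f + g) ≤ Q s f + Q s g
  pos_homog : ∀ (s : List X) (l : ℝ) (f : X → ℝ), 0 ≤ l → Q s (l • f) = l * Q s f

/-- A (real-valued) supermartingale for the upper expectation tree `Q`. -/
def IsSupermart (Q : UpperExpTree X) (M : List X → ℝ) : Prop :=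
  ∀ s : List X, Q.Q s (fun x => M (s ++ [x])) ≤ M s

/-- The game-theoretic upper expectation of a real-valued variable (used on gambles):
the infimum of `M s` over bounded-below supermartingales `M` with
`liminf_k M(ω^k) ≥ f(ω)` on `Γ(s)`. -/
noncomputable def gtG (Q : UpperExpTree X) (f : Path X → ℝ) (s : List X) : EReal :=
  sInf {a : EReal | ∃ M : List X → ℝ, IsSupermart Q M ∧ (∃ B : ℝ, ∀ t, B ≤ M t) ∧
    (∀ ω ∈ cyl s,
      (f ω : EReal) ≤ Filter.liminf (fun k => ((M (prefixList ω k) : ℝ) : EReal)) atTop) ∧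
    a = ((M s : ℝ) : EReal)}

/-- Extension to bounded-below variables, by continuity w.r.t. upper cuts:
`Ē(f|s) = lim_{c → +∞} Ē(min(f,c)|s)` (the limit of this nondecreasing net is a supremum). -/
noncomputable def gtBB (Q : UpperExpTree X) (f : Path X → EReal) (s : List X) : EReal :=
  ⨆ c : ℝ, gtG Q (fun ω => (f ω ⊓ (c : EReal)).toReal) s

/-- The game-theoretic global upper expectation `Ē_Q̄`, extended to all extended
real variables by continuity w.r.t. lower cuts:
`Ē(f|s) = lim_{c → −∞} Ē(max(f,c)|s)` (the limit of this nonincreasing net is an infimum). -/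
noncomputable def gtUE (Q : UpperExpTree X) (f : Path X → EReal) (s : List X) : EReal :=
  ⨅ c : ℝ, gtBB Q (fun ω => f ω ⊔ (c : EReal)) s

/-- A precise probability tree: a probability mass function at each situation. -/
structure PreciseTree (X : Type) [Fintype X] where
  p : List X → X → ℝ
  nonneg : ∀ (s : List X) (x : X), 0 ≤ p s x
  sum_one : ∀ s : List X, ∑ x, p s x = 1

/-- An imprecise probability tree: a nonempty closed convex set of probability mass
functions at each situation. -/
structure ImpreciseTree (X : Type) [Fintype X] where
  sets : List X → Set (X → ℝ)
  nonempty' : ∀ s : List X, (sets s).Nonempty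
  closed' : ∀ s : List X, IsClosed (sets s)
  convex' : ∀ s : List X, Convex ℝ (sets s)
  prob' : ∀ s : List X, ∀ q ∈ sets s, (∀ x, 0 ≤ q x) ∧ ∑ x, q x = 1

/-- `p ∼ 𝒫`: the precise tree `p` is compatible with the imprecise tree `P`. -/
def Compatible (p : PreciseTree X) (P : ImpreciseTree X) : Prop :=
  ∀ s : List X, p.p s ∈ P.sets s

/-- The probability `P_p(Γ(z)|s)` of the cylinder of `z` conditional on situation `s`. -/
noncomputable def cylProb (p : List X → X → ℝ) (s z : List X) : ℝ :=
  if s.length < z.length ∧ z.take s.length = s then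
    ∏ i ∈ Finset.Ico s.length z.length, p (z.take i) (z.getD i (Classical.arbitrary X))
  else if z.length ≤ s.length ∧ s.take z.length = z then 1 else 0

/-- The σ-algebra `ℱ` on paths generated by the cylinder events. -/
instance cylSigma : MeasurableSpace (Path X) :=
  MeasurableSpace.generateFrom {A | ∃ s : List X, A = cyl s}

/-- `μ` is the probability measure `P_p(·|s)` on `ℱ` determined by the tree `p`. -/
def IsTreeMeasure (p : PreciseTree X) (s : List X) (μ : Measure (Path X)) : Prop :=
  IsProbabilityMeasure μ ∧ ∀ z : List X, μ (cyl z) = ENNReal.ofReal (cylProb p.p s z)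

/-- Positive part of an extended real, in `ℝ≥0∞`. -/
noncomputable def posPart (x : EReal) : ℝ≥0∞ := if x = ⊤ then ⊤ else ENNReal.ofReal x.toReal

/-- The Lebesgue integral `∫ g dμ = ∫ g⁺ dμ − ∫ g⁻ dμ` of an extended-real variable
(well-defined, with value in `(-∞, +∞]`, for bounded-below measurable `g`). -/
noncomputable def integralE (μ : Measure (Path X)) (g : Path X → EReal) : EReal :=
  ((∫⁻ ω, posPart (g ω) ∂μ : ℝ≥0∞) : EReal) - ((∫⁻ ω, posPart (-(g ω)) ∂μ : ℝ≥0∞) : EReal)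

/-- The upper integral `Ē_p(f|s)`: infimum of integrals of bounded-below
`ℱ`-measurable variables dominating `f`. -/
noncomputable def upperInt (μ : Measure (Path X)) (f : Path X → EReal) : EReal :=
  sInf {a : EReal | ∃ g : Path X → EReal, Measurable g ∧ (∃ B : ℝ, ∀ ω, (B : EReal) ≤ g ω) ∧
    (∀ ω, f ω ≤ g ω) ∧ a = integralE μ g}

/-- The measure-theoretic global upper expectation `Ē_𝒫(f|s)`, given the assignment
`Pm` of the measures `P_p(·|s)` to precise trees: the upper envelope of the upper
integrals over all compatible precise trees. -/
noncomputable def muUE (Pm : PreciseTree X → List X → Measure (Path X))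
    (P : ImpreciseTree X) (f : Path X → EReal) (s : List X) : EReal :=
  ⨆ (p : PreciseTree X) (_ : Compatible p P), upperInt (Pm p s) f

/-- The trees `P` and `Q` agree: each `Q̄_s` is the upper envelope of the expectations
corresponding to the credal set `𝒫_s`. -/
def Agree (P : ImpreciseTree X) (Q : UpperExpTree X) : Prop :=
  ∀ (s : List X) (f : X → ℝ),
    Q.Q s f = sSup {r : ℝ | ∃ q ∈ P.sets s, r = ∑ x, f x * q x}

/-- Axioms P1–P5 for a global upper expectation `E` w.r.t. the tree `Q`. -/
structure Axioms (Q : UpperExpTree X) (E : (Path X → EReal) → List X → EReal) : Prop where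
  p1 : ∀ (f : X → ℝ) (s : List X),
    E (fun ω => ((f (ω s.length) : ℝ) : EReal)) s = ((Q.Q s f : ℝ) : EReal)
  p2 : ∀ f : Path X → EReal, IsFinGamble f → ∀ s : List X, E f s = E ((cyl s).indicator f) s
  p3 : ∀ f : Path X → EReal, IsFinGamble f → ∀ s : List X,
    E f s ≤ E (fun ω => E f (prefixList ω (s.length + 1))) s
  p4 : ∀ f g : Path X → EReal, (∀ ω, f ω ≤ g ω) → ∀ s : List X, E f s ≤ E g s
  p5 : ∀ (s : List X) (fn : ℕ → Path X → EReal) (f : Path X → EReal),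
    (∀ n, IsFinGamble (fn n)) → (∃ B : ℝ, ∀ n ω, (B : EReal) ≤ fn n ω) →
    (∀ ω, Tendsto (fun n => fn n ω) atTop (nhds (f ω))) →
    E f s ≤ limsup (fun n => E (fn n) s) atTop

/-- Upper semicontinuity of an extended-real variable on the path space. -/
def USC [TopologicalSpace X] [DiscreteTopology X] (f : Path X → EReal) : Prop :=
  ∀ a : ℝ, IsOpen {ω : Path X | f ω < (a : EReal)}

/-- An `Ω`-capacity (Dellacherie): a monotone `[0,∞]`-valued functional on nonnegative
variables, continuous along nondecreasing sequences, and continuous along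
nonincreasing sequences of nonnegative real-valued upper semicontinuous functions. -/
def IsCapacity [TopologicalSpace X] [DiscreteTopology X]
    (F : (Path X → EReal) → EReal) : Prop :=
  (∀ f : Path X → EReal, (∀ ω, 0 ≤ f ω) → 0 ≤ F f) ∧
  (∀ f g : Path X → EReal, (∀ ω, 0 ≤ f ω) → (∀ ω, 0 ≤ g ω) → (∀ ω, f ω ≤ g ω) → F f ≤ F g) ∧
  (∀ fn : ℕ → Path X → EReal, (∀ n ω, 0 ≤ fn n ω) → Monotone fn →
    Tendsto (fun n => F (fn n)) atTop (nhds (F (fun ω => ⨆ n, fn n ω)))) ∧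
  (∀ fn : ℕ → Path X → EReal, (∀ n ω, 0 ≤ fn n ω ∧ fn n ω < ⊤) → (∀ n, USC (fn n)) →
    Antitone fn →
    Tendsto (fun n => F (fn n)) atTop (nhds (F (fun ω => ⨅ n, fn n ω))))

open Classical in
/-- The metric `δ(ω,ω') = 2^{-n}`, `n` the first (1-based) index where `ω` and `ω'` differ. -/
noncomputable def delta (ω ω' : Path X) : ℝ :=
  if h : ω = ω' then 0
  else (1 / 2 : ℝ) ^ (Nat.find (Function.ne_iff.mp h) + 1)

/-- The product topology on the path space (with `X` discrete). -/
def prodTop (X : Type) : TopologicalSpace (ℕ → X) :=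
  @Pi.topologicalSpace ℕ (fun _ => X) (fun _ => ⊥)


set_option linter.unusedSectionVars false

lemma UpperExpTree.le_add_const (Q : UpperExpTree X) (s : List X) {g h : X → ℝ} {c : ℝ}
    (hgh : ∀ x, g x ≤ h x + c) : Q.Q s g ≤ Q.Q s h + c := by
  have h1 : Q.Q s (h + (g - h)) ≤ Q.Q s h + Q.Q s (g - h) := Q.subadd s h (g - h)
  have h2 : Q.Q s (g - h) ≤ c :=
    (Q.le_sup s _).trans (ciSup_le fun x => by have := hgh x; simp only [Pi.sub_apply]; linarith)
  rw [add_sub_cancel] at h1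
  linarith

lemma UpperExpTree.mono (Q : UpperExpTree X) (s : List X) {g h : X → ℝ}
    (hgh : ∀ x, g x ≤ h x) : Q.Q s g ≤ Q.Q s h := by
  simpa using Q.le_add_const s (c := 0) (by simpa using hgh)

@[simp] lemma length_prefixList (ω : Path X) (k : ℕ) : (prefixList ω k).length = k := by
  simp [prefixList]

lemma take_prefixList (ω : Path X) {j k : ℕ} (h : j ≤ k) :
    (prefixList ω k).take j = prefixList ω j := by
  simp [prefixList, ← List.map_take, List.take_range, h]

lemma prefixList_succ (ω : Path X) (k : ℕ) :
    prefixList ω (k + 1) = prefixList ω k ++ [ω k] := by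
  simp [prefixList, List.range_succ]

lemma prefixList_eq_iff {ω ω' : Path X} {k : ℕ} :
    prefixList ω k = prefixList ω' k ↔ ∀ i < k, ω i = ω' i := by
  simp [prefixList]

lemma mem_cyl {ω : Path X} {s : List X} : ω ∈ cyl s ↔ prefixList ω s.length = s := Iff.rfl

@[simp] lemma mem_cyl_prefixList (ω : Path X) (k : ℕ) : ω ∈ cyl (prefixList ω k) := by
  simp [mem_cyl]

lemma cyl_append_subset (s t : List X) : cyl (s ++ t) ⊆ cyl s := by
  intro ω hω
  rw [mem_cyl] at hω ⊢
  rw [← take_prefixList ω (j := s.length) (k := (s ++ t).length) (by simp), hω]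
  simp

/-! ### Supermartingales -/

lemma isSupermart_const (Q : UpperExpTree X) (c : ℝ) : IsSupermart Q fun _ => c :=
  fun s => (Q.le_sup s _).trans (ciSup_le fun _ => le_rfl)

lemma IsSupermart.add {Q : UpperExpTree X} {M N : List X → ℝ} (hM : IsSupermart Q M)
    (hN : IsSupermart Q N) : IsSupermart Q fun t => M t + N t :=
  fun s => (Q.subadd s (fun x => M (s ++ [x])) (fun x => N (s ++ [x]))).trans
    (add_le_add (hM s) (hN s))

lemma IsSupermart.const_mul {Q : UpperExpTree X} {M : List X → ℝ} (hM : IsSupermart Q M)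
    {c : ℝ} (hc : 0 ≤ c) : IsSupermart Q fun t => c * M t := fun s => by
  have h := Q.pos_homog s c (fun x => M (s ++ [x])) hc
  exact h.le.trans (mul_le_mul_of_nonneg_left (hM s) hc)

lemma IsSupermart.min {Q : UpperExpTree X} {M N : List X → ℝ} (hM : IsSupermart Q M)
    (hN : IsSupermart Q N) : IsSupermart Q fun t => min (M t) (N t) := fun s =>
  le_min ((Q.mono s fun _ => min_le_left _ _).trans (hM s))
    ((Q.mono s fun _ => min_le_right _ _).trans (hN s))

lemma isSupermart_sum {Q : UpperExpTree X} {D : ℕ → List X → ℝ} (hD : ∀ i, IsSupermart Q (D i))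
    (n : ℕ) : IsSupermart Q fun t => ∑ i ∈ Finset.range n, D i t := by
  induction n with
  | zero => simpa using isSupermart_const Q 0
  | succ n ih => simpa only [Finset.sum_range_succ] using ih.add (hD n)

lemma isSupermart_iSup {Q : UpperExpTree X} {Z : ℕ → List X → ℝ} {C : ℝ}
    (hZ : ∀ n, IsSupermart Q (Z n)) (hmono : ∀ t, Monotone fun n => Z n t)
    (hC : ∀ n t, Z n t ≤ C) : IsSupermart Q fun t => ⨆ n, Z n t := by
  intro s
  have hbdd : ∀ t, BddAbove (Set.range fun n => Z n t) := fun t =>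
    ⟨C, by rintro _ ⟨n, rfl⟩; exact hC n t⟩
  refine le_of_forall_pos_le_add fun ε hε => ?_
  have hlim : ∀ x, ∀ᶠ n in atTop, (⨆ n, Z n (s ++ [x])) - ε < Z n (s ++ [x]) := fun x =>
    (tendsto_atTop_ciSup (hmono _) (hbdd _)).eventually (lt_mem_nhds (by linarith))
  obtain ⟨n, hn⟩ := (eventually_all.2 hlim).exists
  calc Q.Q s (fun x => ⨆ n, Z n (s ++ [x]))
      ≤ Q.Q s (fun x => Z n (s ++ [x])) + ε :=
        Q.le_add_const s fun x => by have := hn x; linarith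
    _ ≤ Z n s + ε := by have := hZ n s; linarith
    _ ≤ (⨆ n, Z n s) + ε := by have := le_ciSup (hbdd s) n; linarith

open Classical in
/-- The process that equals `M` until the first situation `v` in `Stop`, and `H v` from then on. -/
noncomputable def glue (Stop : List X → Prop) (H : List X → List X → ℝ) (M : List X → ℝ)
    (t : List X) : ℝ :=
  if h : ∃ k, k ≤ t.length ∧ Stop (t.take k) then H (t.take (Nat.find h)) t else M t

lemma glue_of_first {Stop : List X → Prop} {H : List X → List X → ℝ} {M : List X → ℝ}
    {t : List X} {k : ℕ} (hk : k ≤ t.length) (hs : Stop (t.take k))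
    (hmin : ∀ j < k, ¬ Stop (t.take j)) : glue Stop H M t = H (t.take k) t := by
  classical
  have h : ∃ k, k ≤ t.length ∧ Stop (t.take k) := ⟨k, hk, hs⟩
  have hfind : Nat.find h = k :=
    (Nat.find_eq_iff h).2 ⟨⟨hk, hs⟩, fun j hj hj' => hmin j hj hj'.2⟩
  rw [glue, dif_pos h]
  convert rfl using 3
  convert hfind.symm

lemma glue_of_none {Stop : List X → Prop} {H : List X → List X → ℝ} {M : List X → ℝ}
    {t : List X} (hs : ∀ k ≤ t.length, ¬ Stop (t.take k)) : glue Stop H M t = M t := by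
  rw [glue, dif_neg]
  rintro ⟨k, hk, hk'⟩
  exact hs k hk hk'

lemma exists_first_take {Stop : List X → Prop} (t : List X) :
    (∃ k ≤ t.length, Stop (t.take k) ∧ ∀ j < k, ¬ Stop (t.take j)) ∨
      ∀ k ≤ t.length, ¬ Stop (t.take k) := by
  classical
  by_cases h : ∃ k, k ≤ t.length ∧ Stop (t.take k)
  · refine Or.inl ⟨Nat.find h, (Nat.find_spec h).1, (Nat.find_spec h).2, fun j hj hj' => ?_⟩
    exact Nat.find_min h hj ⟨hj.le.trans (Nat.find_spec h).1, hj'⟩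
  · push Not at h
    exact Or.inr h

lemma isSupermart_glue {Q : UpperExpTree X} {Stop : List X → Prop} {H : List X → List X → ℝ}
    {M : List X → ℝ} (hM : IsSupermart Q M) (hH : ∀ v, IsSupermart Q (H v))
    (hle : ∀ v, Stop v → H v v ≤ M v) : IsSupermart Q (glue Stop H M) := by
  intro t
  have htake : ∀ (x : X) (j : ℕ), j ≤ t.length → (t ++ [x]).take j = t.take j := fun x j hj =>
    List.take_append_of_le_length hj
  rcases exists_first_take (Stop := Stop) t with ⟨k, hk, hs, hmin⟩ | hnone
  · rw [glue_of_first hk hs hmin]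
    refine le_trans (Q.mono t fun x => ?_) (hH (t.take k) t)
    rw [glue_of_first (k := k) (by simp; omega) (by rwa [htake x k hk])
      (fun j hj => by rw [htake x j (by omega)]; exact hmin j hj), htake x k hk]
  · rw [glue_of_none hnone]
    refine le_trans (Q.mono t fun x => ?_) (hM t)
    have hmin : ∀ j < t.length + 1, ¬ Stop ((t ++ [x]).take j) := fun j hj => by
      rw [htake x j (by omega)]; exact hnone j (by omega)
    have hfull : (t ++ [x]).take (t.length + 1) = t ++ [x] := List.take_of_length_le (by simp)
    by_cases hx : Stop (t ++ [x])
    · rw [glue_of_first (k := t.length + 1) (by simp) (by rwa [hfull]) hmin, hfull]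
      exact hle _ hx
    · rw [glue_of_none]
      intro k hk
      rcases Nat.lt_or_ge k (t.length + 1) with h | h
      · exact hmin k h
      · have : k = t.length + 1 := by simp at hk; omega
        rwa [this, hfull]

/-! ### The price of superhedging by nonnegative supermartingales -/

/-- `M` eventually exceeds every number below `f` along each path through `s`. -/
def Superhedges (M : List X → ℝ) (f : Path X → ℝ) (s : List X) : Prop :=
  ∀ ω ∈ cyl s, ∀ r < f ω, ∀ᶠ k in atTop, r < M (prefixList ω k)

lemma coe_le_liminf_iff {u : ℕ → ℝ} {a : ℝ} :
    (a : EReal) ≤ liminf (fun k => ((u k : ℝ) : EReal)) atTop ↔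
      ∀ r < a, ∀ᶠ k in atTop, r < u k := by
  rw [le_liminf_iff]
  constructor
  · intro h r hr
    simpa using h r (by exact_mod_cast hr)
  · intro h y hy
    obtain ⟨r, hr, hra⟩ := EReal.lt_iff_exists_real_btwn.1 hy
    filter_upwards [h r (by exact_mod_cast hra)] with k hk
    exact hr.trans (by exact_mod_cast hk)

/-- The infimum of the initial values of nonnegative supermartingales superhedging `f`. -/
noncomputable def hedgePrice (Q : UpperExpTree X) (f : Path X → ℝ) (s : List X) : ℝ :=
  sInf {a : ℝ | ∃ M : List X → ℝ, IsSupermart Q M ∧ (∀ t, 0 ≤ M t) ∧ Superhedges M f s ∧ M s = a}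

lemma hedgePrice_nonneg (Q : UpperExpTree X) (f : Path X → ℝ) (s : List X) :
    0 ≤ hedgePrice Q f s :=
  Real.sInf_nonneg (by rintro _ ⟨M, -, hM, -, rfl⟩; exact hM s)

lemma hedgePrice_le {Q : UpperExpTree X} {f : Path X → ℝ} {s : List X} {M : List X → ℝ}
    (hM : IsSupermart Q M) (h0 : ∀ t, 0 ≤ M t) (hf : Superhedges M f s) :
    hedgePrice Q f s ≤ M s :=
  csInf_le ⟨0, by rintro _ ⟨M, -, hM, -, rfl⟩; exact hM s⟩ ⟨M, hM, h0, hf, rfl⟩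

lemma hedgePrice_le_const {Q : UpperExpTree X} {f : Path X → ℝ} {s : List X} {C : ℝ}
    (hC : 0 ≤ C) (hf : ∀ ω ∈ cyl s, f ω ≤ C) : hedgePrice Q f s ≤ C :=
  hedgePrice_le (M := fun _ => C) (isSupermart_const Q C) (fun _ => hC)
    fun ω hω _ hr => Eventually.of_forall fun _ => hr.trans_le (hf ω hω)

lemma exists_superhedge {Q : UpperExpTree X} {f : Path X → ℝ} {s : List X} {C a : ℝ}
    (hf : ∀ ω, f ω ≤ C) (ha : hedgePrice Q f s < a) :
    ∃ M : List X → ℝ, IsSupermart Q M ∧ (∀ t, 0 ≤ M t) ∧ Superhedges M f s ∧ M s < a := by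
  have hne : {a : ℝ | ∃ M : List X → ℝ, IsSupermart Q M ∧ (∀ t, 0 ≤ M t) ∧
      Superhedges M f s ∧ M s = a}.Nonempty :=
    ⟨max C 0, fun _ => max C 0, isSupermart_const Q _, fun _ => le_max_right _ _,
      fun ω _ _ hr => Eventually.of_forall fun _ =>
        hr.trans_le ((hf ω).trans (le_max_left _ _)), rfl⟩
  obtain ⟨_, ⟨M, h1, h2, h3, rfl⟩, h4⟩ := exists_lt_of_csInf_lt hne ha
  exact ⟨M, h1, h2, h3, h4⟩

lemma hedgePrice_mono {Q : UpperExpTree X} {f g : Path X → ℝ} {s : List X} {C : ℝ}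
    (hg : ∀ ω, g ω ≤ C) (hfg : ∀ ω, f ω ≤ g ω) : hedgePrice Q f s ≤ hedgePrice Q g s := by
  refine le_of_forall_gt_imp_ge_of_dense fun a ha => ?_
  obtain ⟨M, h1, h2, h3, h4⟩ := exists_superhedge hg ha
  exact (hedgePrice_le h1 h2 fun ω hω r hr => h3 ω hω r (hr.trans_le (hfg ω))).trans h4.le

lemma isSupermart_hedgePrice {Q : UpperExpTree X} {f : Path X → ℝ} {C : ℝ}
    (hf : ∀ ω, f ω ≤ C) : IsSupermart Q (hedgePrice Q f) := by
  intro s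
  refine le_of_forall_gt_imp_ge_of_dense fun a ha => ?_
  obtain ⟨M, h1, h2, h3, h4⟩ := exists_superhedge hf ha
  refine le_trans (Q.mono s fun x => ?_) ((h1 s).trans h4.le)
  exact hedgePrice_le h1 h2 fun ω hω => h3 ω (cyl_append_subset s [x] hω)

/-- Optional switching: it is enough to reach the price of `f` at some later situation. -/
lemma hedgePrice_le_of_reach {Q : UpperExpTree X} {f : Path X → ℝ} {s : List X} {C : ℝ}
    {M : List X → ℝ} (hf : ∀ ω, f ω ≤ C) (hM : IsSupermart Q M) (h0 : ∀ t, 0 ≤ M t)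
    (h : ∀ ω ∈ cyl s, (∀ r < f ω, ∀ᶠ k in atTop, r < M (prefixList ω k)) ∨
      ∃ k ≥ s.length, hedgePrice Q f (prefixList ω k) ≤ M (prefixList ω k)) :
    hedgePrice Q f s ≤ M s := by
  classical
  refine le_of_forall_pos_le_add fun ε hε => ?_
  choose H hH1 hH2 hH3 hH4 using fun v : List X =>
    exists_superhedge (Q := Q) hf (lt_add_of_pos_right (hedgePrice Q f v) hε)
  let Stop : List X → Prop := fun v => s.length ≤ v.length ∧ hedgePrice Q f v ≤ M v
  let N := glue Stop H fun t => M t + ε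
  have hN : IsSupermart Q N := isSupermart_glue (hM.add (isSupermart_const Q ε)) hH1
    fun v hv => (hH4 v).le.trans (by have := hv.2; linarith)
  have hN0 : ∀ t, 0 ≤ N t := fun t => by
    rcases exists_first_take (Stop := Stop) t with ⟨k, hk, hs, hmin⟩ | hnone
    · simp only [N, glue_of_first hk hs hmin]; exact hH2 _ _
    · simp only [N, glue_of_none hnone]; have := h0 t; linarith
  have hhedge : Superhedges N f s := by
    intro ω hω r hr
    by_cases hex : ∃ k, Stop (prefixList ω k)
    · have hv := hH3 (prefixList ω (Nat.find hex)) ω (mem_cyl_prefixList ω _) r hr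
      filter_upwards [hv, eventually_ge_atTop (Nat.find hex)] with k hk hle
      have hN : N (prefixList ω k) =
          H ((prefixList ω k).take (Nat.find hex)) (prefixList ω k) := by
        refine glue_of_first (by simpa using hle) ?_ fun j hj => ?_
        · rw [take_prefixList ω hle]; exact Nat.find_spec hex
        · rw [take_prefixList ω (hj.le.trans hle)]; exact Nat.find_min hex hj
      rwa [hN, take_prefixList ω hle]
    · push Not at hex
      rcases h ω hω with h1 | ⟨k, hk, hle⟩
      · filter_upwards [h1 r hr] with k hk
        have hN : N (prefixList ω k) = M (prefixList ω k) + ε := by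
          refine glue_of_none fun j hj => ?_
          rw [take_prefixList ω (by simpa using hj)]; exact hex j
        rw [hN]; linarith
      · exact absurd ⟨by simpa using hk, hle⟩ (hex k)
  refine (hedgePrice_le hN hN0 hhedge).trans ?_
  rcases exists_first_take (Stop := Stop) s with ⟨k, hk, hs, hmin⟩ | hnone
  · have hks : s.take k = s := by
      have := hs.1
      simp only [List.length_take] at this
      exact List.take_of_length_le (by omega)
    simp only [N, glue_of_first hk hs hmin, hks]
    rw [hks] at hs
    have := hH4 s
    have := hs.2
    linarith
  · simp only [N, glue_of_none hnone]; exact le_rfl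

lemma hedgePrice_le_step {Q : UpperExpTree X} {f : Path X → ℝ} {C : ℝ}
    (hf : ∀ ω, f ω ≤ C) (s : List X) :
    hedgePrice Q f s ≤ Q.Q s fun x => hedgePrice Q f (s ++ [x]) := by
  classical
  have hS := isSupermart_hedgePrice (Q := Q) hf
  have hpos : 0 ≤ Q.Q s fun x => hedgePrice Q f (s ++ [x]) := by
    have h1 : Q.Q s 0 = 0 := by simpa using Q.pos_homog s 0 0 le_rfl
    rw [← h1]
    exact Q.mono s fun x => hedgePrice_nonneg _ _ _
  let M := Function.update (hedgePrice Q f) s (Q.Q s fun x => hedgePrice Q f (s ++ [x]))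
  have hMs : M s = Q.Q s fun x => hedgePrice Q f (s ++ [x]) := Function.update_self ..
  have hne : ∀ t, t ≠ s → M t = hedgePrice Q f t := fun t ht => Function.update_of_ne ht ..
  have hle : ∀ t, M t ≤ hedgePrice Q f t := fun t => by
    by_cases ht : t = s
    · subst ht; rw [hMs]; exact hS t
    · exact (hne t ht).le
  have hM : IsSupermart Q M := fun t => by
    by_cases ht : t = s
    · subst ht
      rw [hMs]
      exact Q.mono t fun x => hle _
    · rw [hne t ht]
      exact (Q.mono t fun x => hle _).trans (hS t)
  rw [← hMs]
  refine hedgePrice_le_of_reach hf hM (fun t => ?_) fun ω _ => Or.inr ⟨s.length + 1, by omega, ?_⟩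
  · by_cases ht : t = s
    · subst ht; rwa [hMs]
    · rw [hne t ht]; exact hedgePrice_nonneg _ _ _
  · rw [hne]
    intro h
    have := congrArg List.length h
    simp at this

/-- A game-theoretic Lévy zero-one law: the price of `f` may stay below a value of `f` only on a
set of price zero. -/
lemma hedgePrice_levy {Q : UpperExpTree X} {f : Path X → ℝ} {C a b : ℝ}
    (hf : ∀ ω, f ω ≤ C) (ha : 0 < a) (hab : a < b) (s : List X) :
    hedgePrice Q (Set.indicator
      {ω | b ≤ f ω ∧ ∃ᶠ k in atTop, hedgePrice Q f (prefixList ω k) < a} fun _ => 1) s = 0 := by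
  set A : Set (Path X) := {ω | b ≤ f ω ∧ ∃ᶠ k in atTop, hedgePrice Q f (prefixList ω k) < a}
  set F : Path X → ℝ := A.indicator fun _ => 1
  have hF1 : ∀ ω, F ω ≤ 1 := fun ω => Set.indicator_le_self' (fun _ _ => zero_le_one) ω
  have hFA : ∀ ω ∉ A, F ω = 0 := fun ω hω => Set.indicator_of_notMem hω _
  have hc1 : ∀ t, hedgePrice Q F t ≤ 1 := fun t =>
    hedgePrice_le_const zero_le_one fun ω _ => hF1 ω
  have hbdd : BddAbove (Set.range (hedgePrice Q F)) := ⟨1, by rintro _ ⟨t, rfl⟩; exact hc1 t⟩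
  set κ := ⨆ t, hedgePrice Q F t
  have hκ : ∀ t, hedgePrice Q F t ≤ κ := fun t => le_ciSup hbdd t
  have hκ0 : 0 ≤ κ := (hedgePrice_nonneg Q F []).trans (hκ [])
  obtain ⟨d, had, hdb⟩ := exists_between hab
  have hd : 0 < d := ha.trans had
  have hlow : ∀ u, hedgePrice Q f u < a → hedgePrice Q F u ≤ κ / d * a := by
    intro u hu
    obtain ⟨M, h1, h2, h3, h4⟩ := exists_superhedge hf hu
    have hκd : 0 ≤ κ / d := by positivity
    refine le_trans (hedgePrice_le_of_reach hF1 (h1.const_mul hκd)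
      (fun t => mul_nonneg hκd (h2 t)) fun ω hω => ?_) (mul_le_mul_of_nonneg_left h4.le hκd)
    by_cases hA : ω ∈ A
    · obtain ⟨k, hk1, hk2⟩ := ((h3 ω hω d (hdb.trans_le hA.1)).and
        (eventually_ge_atTop u.length)).exists
      refine Or.inr ⟨k, hk2, (hκ _).trans ?_⟩
      rw [div_mul_eq_mul_div, le_div_iff₀ hd]
      exact mul_le_mul_of_nonneg_left hk1.le hκ0
    · refine Or.inl fun r hr => Eventually.of_forall fun k => ?_
      rw [hFA ω hA] at hr
      exact hr.trans_le (mul_nonneg hκd (h2 _))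
  have hall : ∀ t, hedgePrice Q F t ≤ κ / d * a := by
    intro t
    have h0 : 0 ≤ κ / d * a := by positivity
    refine hedgePrice_le_of_reach (M := fun _ => κ / d * a) hF1 (isSupermart_const Q _)
      (fun _ => h0) fun ω hω => ?_
    by_cases hA : ω ∈ A
    · obtain ⟨k, hk1, hk2⟩ := (hA.2.and_eventually (eventually_ge_atTop t.length)).exists
      exact Or.inr ⟨k, hk2, hlow _ hk1⟩
    · refine Or.inl fun r hr => Eventually.of_forall fun k => ?_
      rw [hFA ω hA] at hr
      exact hr.trans_le h0
  have hκle : κ ≤ κ / d * a := ciSup_le hall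
  have hκz : κ ≤ 0 := by
    rw [div_mul_eq_mul_div, le_div_iff₀ hd] at hκle
    by_contra! hpos
    nlinarith
  exact le_antisymm ((hκ s).trans hκz) (hedgePrice_nonneg _ _ _)

/-- Continuity of the price from below, along arbitrary nondecreasing sequences. -/
lemma hedgePrice_le_of_monotone {Q : UpperExpTree X} {f : ℕ → Path X → ℝ} {g : Path X → ℝ}
    {s : List X} {C a : ℝ} (hC : 0 ≤ C) (hf : ∀ n ω, f n ω ≤ C) (hmono : Monotone f)
    (hg : ∀ ω, g ω ≤ C) (hsup : ∀ ω, ∀ r < g ω, ∃ n, r < f n ω)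
    (ha : ∀ n, hedgePrice Q (f n) s ≤ a) : hedgePrice Q g s ≤ a := by
  refine le_of_forall_pos_le_add fun ε hε => ?_
  obtain ⟨e, he⟩ := exists_surjective_nat (ℕ × ℚ × ℚ)
  let A : ℕ × ℚ × ℚ → Set (Path X) := fun i => {ω | (i.2.2 : ℝ) ≤ f i.1 ω ∧
    ∃ᶠ k in atTop, hedgePrice Q (f i.1) (prefixList ω k) < (i.2.1 : ℝ)}
  set δ : ℝ := ε / (2 * (C + 1)) with hδ_def
  have hδ : 0 < δ := by positivity
  have hD : ∀ i : ℕ, ∃ D : List X → ℝ, IsSupermart Q D ∧ (∀ t, 0 ≤ D t) ∧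
      D s ≤ (1 / 2 : ℝ) ^ i * δ ∧
      ((0 < (e i).2.1 ∧ (e i).2.1 < (e i).2.2) →
        ∀ ω ∈ cyl s, ω ∈ A (e i) → ∀ r < (1 : ℝ), ∀ᶠ k in atTop, r < D (prefixList ω k)) := by
    intro i
    by_cases hi : 0 < (e i).2.1 ∧ (e i).2.1 < (e i).2.2
    · have h0 := hedgePrice_levy (Q := Q) (hf (e i).1) (a := ((e i).2.1 : ℝ))
        (b := ((e i).2.2 : ℝ)) (by exact_mod_cast hi.1) (by exact_mod_cast hi.2) s
      obtain ⟨D, h1, h2, h3, h4⟩ := exists_superhedge (C := 1)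
        (fun ω => Set.indicator_le_self' (fun _ _ => zero_le_one) ω)
        (h0.trans_lt (by positivity : 0 < (1 / 2 : ℝ) ^ i * δ))
      refine ⟨D, h1, h2, h4.le, fun _ ω hω hA r hr => h3 ω hω r ?_⟩
      have hmem : (A (e i)).indicator (fun _ => (1 : ℝ)) ω = 1 := Set.indicator_of_mem hA _
      exact hr.trans_eq hmem.symm
    · exact ⟨fun _ => 0, isSupermart_const Q 0, fun _ => le_rfl, by positivity,
        fun h => absurd h hi⟩
  choose D hD1 hD2 hD3 hD4 using hD
  let Z : ℕ → List X → ℝ := fun n t =>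
    min C (hedgePrice Q (f n) t + C * ∑ i ∈ Finset.range n, D i t)
  have hZ : ∀ n, IsSupermart Q (Z n) := fun n => (isSupermart_const Q C).min
    ((isSupermart_hedgePrice (hf n)).add ((isSupermart_sum hD1 n).const_mul hC))
  have hZmono : ∀ t, Monotone fun n => Z n t := by
    intro t m n hmn
    refine min_le_min_left C (add_le_add (hedgePrice_mono (hf n) (hmono hmn)) ?_)
    exact mul_le_mul_of_nonneg_left (Finset.sum_le_sum_of_subset_of_nonneg
      (Finset.range_mono hmn) fun i _ _ => hD2 i t) hC
  have hZC : ∀ n t, Z n t ≤ C := fun n t => min_le_left _ _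
  have hbdd : ∀ t, BddAbove (Set.range fun n => Z n t) := fun t =>
    ⟨C, by rintro _ ⟨n, rfl⟩; exact hZC n t⟩
  have hsum0 : ∀ n t, 0 ≤ C * ∑ i ∈ Finset.range n, D i t := fun n t =>
    mul_nonneg hC (Finset.sum_nonneg fun i _ => hD2 i t)
  have hle : ∀ n t, Z n t ≤ ⨆ n, Z n t := fun n t => le_ciSup (hbdd t) n
  have hZ0 : ∀ t, 0 ≤ ⨆ n, Z n t := fun t =>
    le_trans (le_min hC (add_nonneg (hedgePrice_nonneg _ _ _) (hsum0 0 t))) (hle 0 t)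
  refine (hedgePrice_le (isSupermart_iSup hZ hZmono hZC) hZ0 fun ω hω r hr => ?_).trans ?_
  · rcases lt_or_ge r 0 with hr0 | hr0
    · exact Eventually.of_forall fun k => hr0.trans_le (hZ0 _)
    have hrC : r < C := hr.trans_le (hg ω)
    by_cases hex : ∃ i, (0 < (e i).2.1 ∧ (e i).2.1 < (e i).2.2) ∧ ω ∈ A (e i)
    · obtain ⟨i, hi, hA⟩ := hex
      have hCpos : 0 < C := hr0.trans_lt hrC
      filter_upwards [hD4 i hi ω hω hA (r / C) ((div_lt_one hCpos).2 hrC)] with k hk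
      refine lt_of_lt_of_le (lt_min hrC ?_) (hle (i + 1) _)
      rw [div_lt_iff₀' hCpos] at hk
      have h1 : D i (prefixList ω k) ≤ ∑ j ∈ Finset.range (i + 1), D j (prefixList ω k) :=
        Finset.single_le_sum (f := fun j => D j (prefixList ω k)) (fun j _ => hD2 j _)
          (Finset.self_mem_range_succ i)
      have h2 := mul_le_mul_of_nonneg_left h1 hC
      have h3 := hedgePrice_nonneg Q (f (i + 1)) (prefixList ω k)
      linarith
    · push Not at hex
      obtain ⟨n, hn⟩ := hsup ω r hr
      obtain ⟨p, hrp, hpn⟩ := exists_rat_btwn hn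
      obtain ⟨q, hpq, hqn⟩ := exists_rat_btwn hpn
      obtain ⟨i, hi⟩ := he (n, p, q)
      have hp : (0 : ℝ) < p := hr0.trans_lt hrp
      have hnot := hex i (by rw [hi]; exact ⟨by exact_mod_cast hp, by exact_mod_cast hpq⟩)
      have hev : ∀ᶠ k in atTop, ¬ hedgePrice Q (f n) (prefixList ω k) < (p : ℝ) := by
        by_contra hcon
        refine hnot ?_
        rw [hi]
        exact ⟨hqn.le, hcon⟩
      filter_upwards [hev] with k hk
      refine lt_of_lt_of_le (lt_min hrC ?_) (hle n _)
      have := hsum0 n (prefixList ω k)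
      linarith [not_lt.1 hk]
  · refine ciSup_le fun n => (min_le_right _ _).trans (add_le_add (ha n) ?_)
    have h1 : ∑ i ∈ Finset.range n, D i s ≤ 2 * δ :=
      calc ∑ i ∈ Finset.range n, D i s ≤ ∑ i ∈ Finset.range n, (1 / 2 : ℝ) ^ i * δ :=
            Finset.sum_le_sum fun i _ => hD3 i
        _ = (∑ i ∈ Finset.range n, (1 / 2 : ℝ) ^ i) * δ := by rw [Finset.sum_mul]
        _ ≤ 2 * δ := mul_le_mul_of_nonneg_right (sum_geometric_two_le n) hδ.le
    have h2 : (C + 1) * (2 * δ) = ε := by rw [hδ_def]; field_simp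
    nlinarith [mul_le_mul_of_nonneg_left h1 hC]

/-! ### Measurability and topology of the path space -/

lemma measurableSet_cyl (s : List X) : MeasurableSet (cyl s) :=
  MeasurableSpace.measurableSet_generateFrom ⟨s, rfl⟩

lemma measurable_comp_prefixList (G : List X → ℝ) (k : ℕ) :
    Measurable fun ω : Path X => G (prefixList ω k) := by
  intro S _
  have h : (fun ω : Path X => G (prefixList ω k)) ⁻¹' S =
      ⋃ z ∈ {z : List X | z.length = k ∧ G z ∈ S}, cyl z := by
    ext ω
    simp only [Set.mem_preimage, Set.mem_iUnion, Set.mem_ofPred_eq, exists_prop]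
    constructor
    · intro h
      exact ⟨prefixList ω k, ⟨by simp, h⟩, mem_cyl_prefixList ω k⟩
    · rintro ⟨z, ⟨rfl, hz⟩, hω⟩
      rwa [mem_cyl.1 hω]
  rw [h]
  exact MeasurableSet.biUnion (Set.to_countable _) fun z _ => measurableSet_cyl z

lemma cyl_prefixList_eq (ω : Path X) (k : ℕ) :
    cyl (prefixList ω k) = PiNat.cylinder ω k := by
  ext ω'
  rw [mem_cyl, length_prefixList, prefixList_eq_iff]
  rfl

section Topology

variable [TopologicalSpace X] [DiscreteTopology X]

lemma isOpen_cyl (s : List X) : IsOpen (cyl s) := by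
  refine isOpen_iff_forall_mem_open.2 fun ω hω => ⟨PiNat.cylinder ω s.length, ?_,
    PiNat.isOpen_cylinder _ ω s.length, PiNat.self_mem_cylinder ω s.length⟩
  rw [← cyl_prefixList_eq, mem_cyl.1 hω]

lemma borelSpace_path : BorelSpace (Path X) := by
  refine ⟨le_antisymm (MeasurableSpace.generateFrom_le ?_) ?_⟩
  · rintro _ ⟨s, rfl⟩
    exact MeasurableSpace.measurableSet_generateFrom (isOpen_cyl s)
  · rw [(PiNat.isTopologicalBasis_cylinders fun _ : ℕ => X).borel_eq_generateFrom]
    refine MeasurableSpace.generateFrom_le ?_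
    rintro _ ⟨ω, k, rfl⟩
    rw [← cyl_prefixList_eq]
    exact measurableSet_cyl _

lemma exists_cyl_subset {U : Set (Path X)} (hU : IsOpen U) {ω : Path X} (hω : ω ∈ U) :
    ∃ k, cyl (prefixList ω k) ⊆ U := by
  obtain ⟨_, ⟨ω', k, rfl⟩, hmem, hsub⟩ :=
    (PiNat.isTopologicalBasis_cylinders fun _ : ℕ => X).exists_subset_of_mem_open hω hU
  refine ⟨k, ?_⟩
  rwa [cyl_prefixList_eq, PiNat.mem_cylinder_iff_eq.1 hmem]

lemma continuous_comp_prefixList (G : List X → ℝ) (k : ℕ) :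
    Continuous fun ω : Path X => G (prefixList ω k) := by
  refine (IsLocallyConstant.iff_eventually_eq _ |>.2 fun ω => ?_).continuous
  filter_upwards [(isOpen_cyl (prefixList ω k)).mem_nhds (mem_cyl_prefixList ω k)] with ω' hω'
  rw [mem_cyl, length_prefixList] at hω'
  rw [hω']

/-- A measurable function on the path space is continuous along a continuous parametrization of
the path space by the Baire space. -/
lemma exists_continuous_parametrization {f : Path X → ℝ} (hf : Measurable f) :
    ∃ ψ : (ℕ → ℕ) → Path X, Continuous ψ ∧ Function.Surjective ψ ∧
      Continuous fun x => f (ψ x) := by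
  have := borelSpace_path (X := X)
  have : PolishSpace (Path X) := ⟨⟩
  obtain ⟨t', hle, hcont, hpol⟩ := hf.exists_continuous
  obtain ⟨ψ, hψ, hsurj⟩ :=
    @PolishSpace.exists_nat_nat_continuous_surjective (Path X) t' hpol inferInstance
  exact ⟨ψ, continuous_le_rng hle hψ, hsurj, @Continuous.comp _ _ _ _ t' _ _ _ hcont hψ⟩

end Topology

lemma isCompact_pi_Iic (n : ℕ → ℕ) : IsCompact {x : ℕ → ℕ | ∀ i, x i ≤ n i} := by
  have := isCompact_univ_pi fun i => (Set.finite_Iic (n i)).isCompact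
  simpa [Set.pi, Set.mem_Iic] using this

lemma exists_truncation_subset {n : ℕ → ℕ} {U : Set (ℕ → ℕ)} (hU : IsOpen U)
    (hn : {x : ℕ → ℕ | ∀ i, x i ≤ n i} ⊆ U) : ∃ k, {x : ℕ → ℕ | ∀ i < k, x i ≤ n i} ⊆ U := by
  let W : ℕ → Set (ℕ → ℕ) := fun N => {x | PiNat.cylinder x N ⊆ U}
  have hW : ∀ N, IsOpen (W N) := fun N => by
    refine isOpen_iff_forall_mem_open.2 fun x hx => ⟨PiNat.cylinder x N, fun y hy => ?_,
      PiNat.isOpen_cylinder _ x N, PiNat.self_mem_cylinder x N⟩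
    have : PiNat.cylinder y N ⊆ U := by rw [PiNat.mem_cylinder_iff_eq.1 hy]; exact hx
    exact this
  have hmono : Monotone W := fun a b hab x hx => (PiNat.cylinder_anti x hab).trans hx
  obtain ⟨N, hN⟩ := (isCompact_pi_Iic n).elim_directed_cover W hW (fun x hx => by
    obtain ⟨_, ⟨y, k, rfl⟩, hmem, hsub⟩ :=
      (PiNat.isTopologicalBasis_cylinders fun _ : ℕ => ℕ).exists_subset_of_mem_open (hn hx) hU
    refine Set.mem_iUnion.2 ⟨k, ?_⟩
    have : PiNat.cylinder x k ⊆ U := by rwa [PiNat.mem_cylinder_iff_eq.1 hmem]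
    exact this) hmono.directed_le
  refine ⟨N, fun y hy => ?_⟩
  have hx : (fun i => if i < N then y i else 0) ∈ W N := hN fun i => by
    by_cases hi : i < N
    · simpa [hi] using hy i hi
    · simp [hi]
  exact hx fun i hi => by simp [hi]

/-- Capacitability: the price of `f` is almost exhausted by the image of a compact set. -/
lemma exists_compact_lt_hedgePrice {Q : UpperExpTree X} {f : Path X → ℝ} {s : List X} {C a : ℝ}
    (hC : 0 ≤ C) (hf0 : ∀ ω, 0 ≤ f ω) (hfC : ∀ ω, f ω ≤ C) {ψ : (ℕ → ℕ) → Path X}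
    (hψ : Function.Surjective ψ) (ha : a < hedgePrice Q f s) :
    ∃ K : Set (ℕ → ℕ), IsCompact K ∧
      ∀ U, IsOpen U → K ⊆ U → a < hedgePrice Q ((ψ '' U).indicator f) s := by
  have hind : ∀ (A : Set (Path X)) ω, A.indicator f ω ≤ C := fun A ω =>
    (Set.indicator_le_self' (fun _ _ => hf0 _) ω).trans (hfC ω)
  have hmono : ∀ {A B : Set (ℕ → ℕ)}, A ⊆ B → (ψ '' A).indicator f ≤ (ψ '' B).indicator f :=
    fun hAB => Set.indicator_le_indicator_of_subset (Set.image_mono hAB) hf0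
  have hstep : ∀ (k : ℕ) (A : {A : Set (ℕ → ℕ) // a < hedgePrice Q ((ψ '' A).indicator f) s}),
      ∃ j, a < hedgePrice Q ((ψ '' (A.1 ∩ {x | x k ≤ j})).indicator f) s := by
    rintro k ⟨A, hA⟩
    by_contra! hcon
    refine hA.not_ge (hedgePrice_le_of_monotone hC (fun n => hind _) (fun m n hmn => ?_) (hind _)
      (fun ω r hr => ?_) hcon)
    · exact hmono (Set.inter_subset_inter_right A fun x hx => le_trans hx hmn)
    · by_cases hω : ω ∈ ψ '' A
      · obtain ⟨x, hx, rfl⟩ := hω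
        refine ⟨x k, ?_⟩
        rw [Set.indicator_of_mem (Set.mem_image_of_mem ψ hx)] at hr
        have hmem : ψ x ∈ ψ '' (A ∩ {y | y k ≤ x k}) := ⟨x, ⟨hx, le_refl (x k)⟩, rfl⟩
        rwa [Set.indicator_of_mem hmem]
      · rw [Set.indicator_of_notMem hω] at hr
        exact ⟨0, hr.trans_le (Set.indicator_nonneg (fun _ _ => hf0 _) ω)⟩
  choose j hj using hstep
  let B : ℕ → {A : Set (ℕ → ℕ) // a < hedgePrice Q ((ψ '' A).indicator f) s} := fun k =>
    Nat.rec ⟨Set.univ, by simpa [Set.image_univ, hψ.range_eq] using ha⟩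
      (fun k A => ⟨A.1 ∩ {x | x k ≤ j k A}, hj k A⟩) k
  let n : ℕ → ℕ := fun k => j k (B k)
  have hB : ∀ k, (B k).1 = {x | ∀ i < k, x i ≤ n i} := by
    intro k
    induction k with
    | zero => simp [B]
    | succ k ih =>
      have : (B (k + 1)).1 = (B k).1 ∩ {x | x k ≤ n k} := rfl
      rw [this, ih]
      ext x
      simp only [Set.mem_inter_iff, Set.mem_ofPred_eq, Nat.forall_lt_succ_right]
  refine ⟨_, isCompact_pi_Iic n, fun U hU hKU => ?_⟩
  obtain ⟨k, hk⟩ := exists_truncation_subset hU hKU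
  have hBk := (B k).2
  rw [hB k] at hBk
  exact hBk.trans_le (hedgePrice_mono (hind _) (hmono hk))

/-! ### Expectations under a precise tree -/

lemma cylProb_of_length_le (p : List X → X → ℝ) {s z : List X} (h : s.length ≤ z.length) :
    cylProb p s z = if z.take s.length = s then
      ∏ i ∈ Finset.Ico s.length z.length, p (z.take i) (z.getD i (Classical.arbitrary X))
      else 0 := by
  rcases h.lt_or_eq with h | h
  · simp only [cylProb, h, true_and, h.not_ge, false_and, if_false]
  · have hs : s.take z.length = s := List.take_of_length_le h.le
    have hsz : s = z ↔ z = s := eq_comm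
    simp only [cylProb, hs, hsz, h, List.take_length, lt_irrefl, false_and, if_false, le_refl, true_and,
      Finset.Ico_self, Finset.prod_empty]

lemma cylProb_nonneg (p : PreciseTree X) (s z : List X) : 0 ≤ cylProb p.p s z := by
  unfold cylProb
  split_ifs
  · exact Finset.prod_nonneg fun i _ => p.nonneg _ _
  · exact zero_le_one
  · exact le_rfl

lemma cylProb_self (p : List X → X → ℝ) (s : List X) : cylProb p s s = 1 := by
  simp [cylProb_of_length_le]

lemma cylProb_append_singleton (p : List X → X → ℝ) {s z : List X} (h : s.length ≤ z.length)
    (x : X) : cylProb p s (z ++ [x]) = cylProb p s z * p z x := by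
  rw [cylProb_of_length_le p h, cylProb_of_length_le p (by simp; omega),
    List.take_append_of_le_length h, ite_mul, zero_mul]
  refine if_congr Iff.rfl ?_ rfl
  rw [List.length_append, List.length_singleton, Finset.prod_Ico_succ_top h]
  congr 1
  · refine Finset.prod_congr rfl fun i hi => ?_
    have hi' := (Finset.mem_Ico.1 hi).2
    rw [List.take_append_of_le_length hi'.le, List.getD_append _ _ _ _ hi']
  · simp

lemma comp_prefixList_eq_sum (G : List X → ℝ) (k : ℕ) (ω : Path X) :
    G (prefixList ω k) =
      ∑ z : Fin k → X, (cyl (List.ofFn z)).indicator (fun _ => G (List.ofFn z)) ω := by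
  have hω : List.ofFn (fun i : Fin k => ω i) = prefixList ω k :=
    List.ext_getElem (by simp) fun i h1 h2 => by simp [prefixList]
  rw [Finset.sum_eq_single_of_mem (fun i : Fin k => ω i) (Finset.mem_univ _), hω,
    Set.indicator_of_mem (mem_cyl_prefixList ω k)]
  intro z _ hz
  refine Set.indicator_of_notMem (fun hmem => hz ?_) _
  rw [mem_cyl, List.length_ofFn, ← hω] at hmem
  exact (List.ofFn_injective hmem).symm

lemma integrable_comp_prefixList (μ : Measure (Path X)) [IsFiniteMeasure μ] (G : List X → ℝ)
    (k : ℕ) : Integrable (fun ω => G (prefixList ω k)) μ := by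
  simp only [comp_prefixList_eq_sum G k]
  exact integrable_finsetSum _ fun z _ =>
    (integrable_const _).indicator (measurableSet_cyl _)

lemma integral_comp_prefixList (μ : Measure (Path X)) [IsFiniteMeasure μ] (G : List X → ℝ)
    (k : ℕ) : ∫ ω, G (prefixList ω k) ∂μ =
      ∑ z : Fin k → X, μ.real (cyl (List.ofFn z)) * G (List.ofFn z) := by
  simp only [comp_prefixList_eq_sum G k]
  rw [integral_finsetSum _ fun z _ => (integrable_const _).indicator (measurableSet_cyl _)]
  refine Finset.sum_congr rfl fun z _ => ?_
  rw [integral_indicator_const _ (measurableSet_cyl _), smul_eq_mul]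

section TreeMeasure

variable {p : PreciseTree X} {s : List X} {μ : Measure (Path X)}

lemma IsTreeMeasure.real_cyl (hμ : IsTreeMeasure p s μ) (z : List X) :
    μ.real (cyl z) = cylProb p.p s z := by
  rw [Measure.real, hμ.2 z, ENNReal.toReal_ofReal (cylProb_nonneg p s z)]

lemma IsTreeMeasure.ae_mem_cyl (hμ : IsTreeMeasure p s μ) : ∀ᵐ ω ∂μ, ω ∈ cyl s := by
  have := hμ.1
  refine (mem_ae_iff_prob_eq_one (measurableSet_cyl s)).2 ?_
  rw [hμ.2 s, cylProb_self, ENNReal.ofReal_one]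

lemma IsTreeMeasure.integral_prefixList_succ (hμ : IsTreeMeasure p s μ) (G : List X → ℝ) {k : ℕ}
    (hk : s.length ≤ k) : ∫ ω, G (prefixList ω (k + 1)) ∂μ =
      ∫ ω, ∑ x, p.p (prefixList ω k) x * G (prefixList ω k ++ [x]) ∂μ := by
  have := hμ.1
  rw [integral_comp_prefixList μ G (k + 1),
    integral_comp_prefixList μ (fun t => ∑ x, p.p t x * G (t ++ [x])) k,
    ← (Fin.snocEquiv fun _ : Fin (k + 1) => X).sum_comp, Fintype.sum_prod_type, Finset.sum_comm]
  refine Finset.sum_congr rfl fun z _ => ?_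
  rw [Finset.mul_sum]
  refine Finset.sum_congr rfl fun x _ => ?_
  have h : List.ofFn (Fin.snocEquiv (fun _ : Fin (k + 1) => X) (x, z)) = List.ofFn z ++ [x] := by
    rw [List.ofFn_succ', List.concat_eq_append]
    simp [Fin.snocEquiv]
  rw [h, hμ.real_cyl, hμ.real_cyl, cylProb_append_singleton p.p (by simpa using hk), mul_assoc]

lemma IsTreeMeasure.integral_prefixList_le (hμ : IsTreeMeasure p s μ) {M : List X → ℝ}
    (hM : ∀ t, ∑ x, p.p t x * M (t ++ [x]) ≤ M t) {k : ℕ} (hk : s.length ≤ k) :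
    ∫ ω, M (prefixList ω k) ∂μ ≤ M s := by
  have := hμ.1
  induction k, hk using Nat.le_induction with
  | base =>
    have h : (fun ω => M (prefixList ω s.length)) =ᵐ[μ] fun _ => M s := by
      filter_upwards [hμ.ae_mem_cyl] with ω hω
      rw [mem_cyl.1 hω]
    rw [integral_congr_ae h]
    simp
  | succ k hk ih =>
    rw [hμ.integral_prefixList_succ M hk]
    exact (integral_mono
      (integrable_comp_prefixList μ (fun t => ∑ x, p.p t x * M (t ++ [x])) k)
      (integrable_comp_prefixList μ M k) fun ω => hM _).trans ih

lemma IsTreeMeasure.integral_le_of_superhedges (hμ : IsTreeMeasure p s μ) {M : List X → ℝ}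
    (hM : ∀ t, ∑ x, p.p t x * M (t ++ [x]) ≤ M t) {B : ℝ} (hB : ∀ t, B ≤ M t) {h : Path X → ℝ}
    (hint : Integrable h μ) (hBh : ∀ ω, B ≤ h ω) (hsup : Superhedges M h s) :
    ∫ ω, h ω ∂μ ≤ M s := by
  have := hμ.1
  have h1 : ∫⁻ ω, ENNReal.ofReal (h ω - B) ∂μ ≤ ENNReal.ofReal (M s - B) := calc
    ∫⁻ ω, ENNReal.ofReal (h ω - B) ∂μ
      ≤ ∫⁻ ω, liminf (fun k => ENNReal.ofReal (M (prefixList ω k) - B)) atTop ∂μ := by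
        refine lintegral_mono_ae ?_
        filter_upwards [hμ.ae_mem_cyl] with ω hω
        rw [le_liminf_iff]
        intro y hy
        have hy' : y ≠ ⊤ := hy.ne_top
        rw [ENNReal.lt_ofReal_iff_toReal_lt hy'] at hy
        filter_upwards [hsup ω hω (y.toReal + B) (by linarith)] with k hk
        rw [ENNReal.lt_ofReal_iff_toReal_lt hy']
        linarith
    _ ≤ liminf (fun k => ∫⁻ ω, ENNReal.ofReal (M (prefixList ω k) - B) ∂μ) atTop :=
        lintegral_liminf_le fun k =>
          (measurable_comp_prefixList (fun t => M t - B) k).ennreal_ofReal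
    _ ≤ ENNReal.ofReal (M s - B) := by
        refine liminf_le_of_frequently_le' (Eventually.frequently ?_)
        filter_upwards [eventually_ge_atTop s.length] with k hk
        rw [← ofReal_integral_eq_lintegral_ofReal
          (integrable_comp_prefixList μ (fun t => M t - B) k)
          (Eventually.of_forall fun ω => sub_nonneg.2 (hB _))]
        refine ENNReal.ofReal_le_ofReal ?_
        rw [integral_sub (integrable_comp_prefixList μ M k) (integrable_const B)]
        simpa using hμ.integral_prefixList_le hM hk
  have h2 := ENNReal.toReal_le_of_le_ofReal (sub_nonneg.2 (hB s)) h1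
  rw [← integral_eq_lintegral_of_nonneg_ae
    (Eventually.of_forall fun ω => sub_nonneg.2 (hBh ω))
    (hint.sub (integrable_const B)).aestronglyMeasurable,
    integral_sub hint (integrable_const B)] at h2
  simpa using h2

end TreeMeasure

/-! ### The integral of extended real variables -/

lemma coe_integral_le_integralE {μ : Measure (Path X)} {h : Path X → ℝ} (hint : Integrable h μ)
    {g : Path X → EReal} (hg : ∀ ω, (h ω : EReal) ≤ g ω) :
    ((∫ ω, h ω ∂μ : ℝ) : EReal) ≤ integralE μ g := by
  have hcoe : ∀ r : ℝ, posPart (r : EReal) = ENNReal.ofReal r := fun r => by simp [posPart]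
  have hmono : ∀ {x y : EReal}, x ≤ y → posPart x ≤ posPart y :=
    fun hxy => EReal.toENNReal_le_toENNReal hxy
  have hfin : ∀ {u : Path X → ℝ}, Integrable u μ → ∫⁻ ω, ENNReal.ofReal (u ω) ∂μ ≠ ⊤ :=
    fun hu => hu.lintegral_lt_top.ne
  have hneg : ∫⁻ ω, ENNReal.ofReal (-h ω) ∂μ ≠ ⊤ := hfin hint.neg
  rw [integral_eq_lintegral_pos_part_sub_lintegral_neg_part hint, EReal.coe_sub,
    EReal.coe_ennreal_toReal (hfin hint), EReal.coe_ennreal_toReal hneg]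
  refine EReal.sub_le_sub (EReal.coe_ennreal_le_coe_ennreal_iff.2 (lintegral_mono fun ω => ?_))
    (EReal.coe_ennreal_le_coe_ennreal_iff.2 (lintegral_mono fun ω => ?_))
  · rw [← hcoe]
    exact hmono (hg ω)
  · rw [← hcoe, EReal.coe_neg]
    exact hmono (EReal.neg_le_neg_iff.2 (hg ω))

lemma coe_toReal_inf {x : EReal} {B : ℝ} (hx : (B : EReal) ≤ x) (c : ℝ) :
    (((x ⊓ (c : EReal)).toReal : ℝ) : EReal) = x ⊓ (c : EReal) := by
  refine EReal.coe_toReal (ne_of_lt (inf_le_right.trans_lt (EReal.coe_lt_top c))) ?_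
  exact (lt_inf_iff.2 ⟨(EReal.bot_lt_coe B).trans_le hx, EReal.bot_lt_coe c⟩).ne'

lemma measurable_toReal_inf {g : Path X → EReal} (hg : Measurable g) (c : ℝ) :
    Measurable fun ω => (g ω ⊓ (c : EReal)).toReal :=
  (hg.inf measurable_const).ereal_toReal

lemma min_le_toReal_inf {x : EReal} {B : ℝ} (hx : (B : EReal) ≤ x) (c : ℝ) :
    min B c ≤ (x ⊓ (c : EReal)).toReal := by
  rw [← EReal.coe_le_coe_iff, coe_toReal_inf hx]
  exact le_inf ((EReal.coe_le_coe_iff.2 (min_le_left _ _)).trans hx)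
    (EReal.coe_le_coe_iff.2 (min_le_right _ _))

lemma toReal_inf_le {x : EReal} {B : ℝ} (hx : (B : EReal) ≤ x) (c : ℝ) :
    (x ⊓ (c : EReal)).toReal ≤ c := by
  rw [← EReal.coe_le_coe_iff, coe_toReal_inf hx]
  exact inf_le_right

lemma integrable_toReal_inf (μ : Measure (Path X)) [IsFiniteMeasure μ] {g : Path X → EReal}
    (hg : Measurable g) {B : ℝ} (hB : ∀ ω, (B : EReal) ≤ g ω) (c : ℝ) :
    Integrable (fun ω => (g ω ⊓ (c : EReal)).toReal) μ :=
  Integrable.of_mem_Icc (min B c) c (measurable_toReal_inf hg c).aemeasurable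
    (Eventually.of_forall fun ω => ⟨min_le_toReal_inf (hB ω) c, toReal_inf_le (hB ω) c⟩)

lemma integralE_le {μ : Measure (Path X)} [IsProbabilityMeasure μ] {g : Path X → EReal}
    (hg : Measurable g) {B : ℝ} (hB : ∀ ω, (B : EReal) ≤ g ω) {L : EReal}
    (hL : ∀ c : ℝ, ((∫ ω, (g ω ⊓ (c : EReal)).toReal ∂μ : ℝ) : EReal) ≤ L) :
    integralE μ g ≤ L := by
  set N : ℝ≥0∞ := ∫⁻ ω, posPart (-(g ω)) ∂μ with hN_def
  set a : ℕ → ℝ≥0∞ := fun n => ∫⁻ ω, ENNReal.ofReal (g ω ⊓ ((n : ℝ) : EReal)).toReal ∂μ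
    with ha_def
  have hpos : ∀ (n : ℕ) ω,
      ENNReal.ofReal (g ω ⊓ ((n : ℝ) : EReal)).toReal = (g ω ⊓ ((n : ℝ) : EReal)).toENNReal :=
    fun n ω => by
      rw [EReal.toENNReal_of_ne_top]
      exact ne_of_lt (inf_le_right.trans_lt (EReal.coe_lt_top _))
  have hneg : ∀ (n : ℕ) ω,
      ENNReal.ofReal (-(g ω ⊓ ((n : ℝ) : EReal)).toReal) = posPart (-(g ω)) := fun n ω => by
    have h1 : posPart (-(g ω)) = (-(g ω)).toENNReal := rfl
    rcases le_total (g ω) ((n : ℝ) : EReal) with h | h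
    · rw [inf_eq_left.2 h, h1, EReal.toENNReal_of_ne_top, EReal.toReal_neg_eq]
      rw [Ne, EReal.neg_eq_top_iff]
      exact ((EReal.bot_lt_coe B).trans_le (hB ω)).ne'
    · have hn : (0 : EReal) ≤ ((n : ℝ) : EReal) := by exact_mod_cast n.cast_nonneg (α := ℝ)
      rw [inf_eq_right.2 h, h1, EReal.toENNReal_of_nonpos (by simpa using hn.trans h),
        EReal.toReal_coe, ENNReal.ofReal_of_nonpos (by simp)]
  have hint := fun n : ℕ => integrable_toReal_inf μ hg hB (n : ℝ)
  have hNfin : N ≠ ⊤ := by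
    have h := (hint 0).neg.lintegral_lt_top.ne
    simp only [Pi.neg_apply, hneg] at h
    exact h
  have hafin : ∀ n, a n ≠ ⊤ := fun n => (hint n).lintegral_lt_top.ne
  have hsup : ∫⁻ ω, posPart (g ω) ∂μ = ⨆ n, a n := by
    rw [ha_def, ← lintegral_iSup (fun n => (measurable_toReal_inf hg n).ennreal_ofReal)]
    · refine lintegral_congr fun ω => ?_
      simp only [hpos]
      refine le_antisymm ?_ (iSup_le fun n => EReal.toENNReal_le_toENNReal inf_le_left)
      change (g ω).toENNReal ≤ _
      rcases eq_or_ne (g ω) ⊤ with htop | htop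
      · simp only [htop, top_inf_eq, EReal.toENNReal_top, top_le_iff]
        refine Eq.trans (iSup_congr fun n => ?_) ENNReal.iSup_natCast
        rw [EReal.toENNReal_of_ne_top (EReal.coe_ne_top _), EReal.toReal_coe,
          ENNReal.ofReal_natCast]
      · obtain ⟨n, hn⟩ := exists_nat_ge (g ω).toReal
        refine le_iSup_of_le n (EReal.toENNReal_le_toENNReal (le_inf le_rfl ?_))
        exact (EReal.le_coe_toReal htop).trans (EReal.coe_le_coe_iff.2 hn)
    · intro m n hmn ω
      simp only [hpos]
      refine EReal.toENNReal_le_toENNReal (inf_le_inf_left _ ?_)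
      exact_mod_cast hmn
  have hle : ∀ n, (a n : EReal) ≤ L + N := fun n => by
    have h := hL n
    rw [integral_eq_lintegral_pos_part_sub_lintegral_neg_part (hint n), EReal.coe_sub] at h
    simp only [hneg] at h
    rw [EReal.coe_ennreal_toReal (hafin n), EReal.coe_ennreal_toReal hNfin] at h
    exact (EReal.sub_le_iff_le_add (Or.inl (EReal.coe_ennreal_ne_bot _))
      (Or.inl (by simpa using hNfin))).1 h
  have h0 : 0 ≤ L + N := (EReal.coe_ennreal_nonneg _).trans (hle 0)
  rw [integralE, hsup, ← hN_def, EReal.sub_le_iff_le_add (Or.inl (EReal.coe_ennreal_ne_bot _))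
    (Or.inl (by simpa using hNfin)), ← EReal.coe_toENNReal h0,
    EReal.coe_ennreal_le_coe_ennreal_iff]
  refine iSup_le fun n => ?_
  rw [← EReal.coe_ennreal_le_coe_ennreal_iff, EReal.coe_toENNReal h0]
  exact hle n

/-! ### Compatible trees -/

section Agreement

variable {P : ImpreciseTree X} {Q : UpperExpTree X}

lemma Agree.sum_le (h : Agree P Q) {t : List X} {q : X → ℝ} (hq : q ∈ P.sets t) (f : X → ℝ) :
    ∑ x, q x * f x ≤ Q.Q t f := by
  rw [h t f]
  refine le_csSup ⟨⨆ x, f x, ?_⟩ ⟨q, hq, Finset.sum_congr rfl fun x _ => mul_comm _ _⟩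
  rintro _ ⟨q', hq', rfl⟩
  obtain ⟨h0, h1⟩ := P.prob' t q' hq'
  calc ∑ x, f x * q' x ≤ ∑ x, (⨆ y, f y) * q' x := Finset.sum_le_sum fun x _ =>
        mul_le_mul_of_nonneg_right (le_ciSup (Set.finite_range f).bddAbove x) (h0 x)
    _ = ⨆ x, f x := by rw [← Finset.mul_sum, h1, mul_one]

lemma Agree.exists_le_sum (h : Agree P Q) (t : List X) (f : X → ℝ) :
    ∃ q ∈ P.sets t, Q.Q t f ≤ ∑ x, q x * f x := by
  have hcomp : IsCompact (P.sets t) :=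
    (isCompact_stdSimplex ℝ X).of_isClosed_subset (P.closed' t) fun q hq => P.prob' t q hq
  have hcont : Continuous fun q : X → ℝ => ∑ x, q x * f x := by fun_prop
  obtain ⟨q, hq, hmax⟩ := hcomp.exists_isMaxOn (P.nonempty' t) hcont.continuousOn
  refine ⟨q, hq, ?_⟩
  rw [h t f]
  refine csSup_le ⟨_, q, hq, rfl⟩ ?_
  rintro _ ⟨q', hq', rfl⟩
  simp only [mul_comm (f _)]
  exact hmax hq'

lemma Agree.isSupermart_sum_le (h : Agree P Q) {p : PreciseTree X} (hp : Compatible p P)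
    {M : List X → ℝ} (hM : IsSupermart Q M) (t : List X) :
    ∑ x, p.p t x * M (t ++ [x]) ≤ M t :=
  (h.sum_le (hp t) fun x => M (t ++ [x])).trans (hM t)

/-- A process that never exceeds its one-step upper expectation is dominated by its one-step
expectations under some compatible precise tree. -/
lemma Agree.exists_compatible (h : Agree P Q) {V : List X → ℝ}
    (hV : ∀ t, V t ≤ Q.Q t fun x => V (t ++ [x])) :
    ∃ p : PreciseTree X, Compatible p P ∧ ∀ t, V t ≤ ∑ x, p.p t x * V (t ++ [x]) := by
  choose q hq hle using fun t => h.exists_le_sum t fun x => V (t ++ [x])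
  exact ⟨⟨q, fun t => (P.prob' t _ (hq t)).1, fun t => (P.prob' t _ (hq t)).2⟩, hq,
    fun t => (hV t).trans (hle t)⟩

end Agreement

lemma iInf_hedgePrice_le_step (Q : UpperExpTree X) {g : ℕ → Path X → ℝ} {C : ℝ}
    (hg : ∀ m ω, g m ω ≤ C) (hanti : Antitone g) (t : List X) :
    ⨅ m, hedgePrice Q (g m) t ≤ Q.Q t fun x => ⨅ m, hedgePrice Q (g m) (t ++ [x]) := by
  have hbdd : ∀ t, BddBelow (Set.range fun m => hedgePrice Q (g m) t) := fun t =>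
    ⟨0, by rintro _ ⟨m, rfl⟩; exact hedgePrice_nonneg Q _ t⟩
  refine le_of_forall_pos_le_add fun ε hε => ?_
  choose n hn using fun x => exists_lt_of_ciInf_lt
    (lt_add_of_pos_right (⨅ m, hedgePrice Q (g m) (t ++ [x])) hε)
  let N := Finset.univ.sup n
  refine (ciInf_le (hbdd t) N).trans ((hedgePrice_le_step (hg N) t).trans ?_)
  refine Q.le_add_const t fun x => le_trans ?_ (hn x).le
  exact hedgePrice_mono (hg _) (hanti (Finset.le_sup (Finset.mem_univ x)))

/-- The game-theoretic price of a bounded measurable variable is approximated by its expectations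
under compatible precise trees. -/
lemma exists_compatible_hedgePrice_le {P : ImpreciseTree X} {Q : UpperExpTree X}
    {Pm : PreciseTree X → List X → Measure (Path X)}
    (hPm : ∀ (p : PreciseTree X) (s : List X), IsTreeMeasure p s (Pm p s)) (hagree : Agree P Q)
    {f : Path X → ℝ} (hf : Measurable f) {C : ℝ} (hC : 0 ≤ C) (hf0 : ∀ ω, 0 ≤ f ω)
    (hfC : ∀ ω, f ω ≤ C) (s : List X) {ε : ℝ} (hε : 0 < ε) :
    ∃ p, Compatible p P ∧ hedgePrice Q f s ≤ ∫ ω, f ω ∂(Pm p s) + ε := by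
  let _ : TopologicalSpace X := ⊥
  have : DiscreteTopology X := ⟨rfl⟩
  obtain ⟨δ, hδ, rfl⟩ : ∃ δ : ℝ, 0 < δ ∧ ε = 3 * δ := ⟨ε / 3, by positivity, by ring⟩
  obtain ⟨ψ, hψ, hsurj, hfψ⟩ := exists_continuous_parametrization hf
  obtain ⟨K, hK, hKU⟩ := exists_compact_lt_hedgePrice (a := hedgePrice Q f s - δ) (Q := Q) (s := s)
    hC hf0 hfC hsurj (by linarith)
  set g : Path X → ℝ := (ψ '' K).indicator f with hg_def
  have hg0 : ∀ ω, 0 ≤ g ω := fun ω => Set.indicator_nonneg (fun _ _ => hf0 _) ω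
  have hgC : ∀ ω, g ω ≤ C := fun ω => (Set.indicator_le_self' (fun _ _ => hf0 _) ω).trans (hfC ω)
  let G : List X → ℝ := fun t => sSup (g '' cyl t) + δ
  have hbdd : ∀ t, BddAbove (g '' cyl t) := fun t =>
    ⟨C, by rintro _ ⟨ω, -, rfl⟩; exact hgC ω⟩
  have hG0 : ∀ t, 0 ≤ G t := fun t =>
    add_nonneg (Real.sSup_nonneg (by rintro _ ⟨ω, -, rfl⟩; exact hg0 ω)) hδ.le
  have hGC : ∀ t, G t ≤ C + δ := fun t =>
    add_le_add_left (Real.sSup_le (by rintro _ ⟨ω, -, rfl⟩; exact hgC ω) hC) δ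
  have hgG : ∀ ω k, g ω < G (prefixList ω k) := fun ω k => by
    have := le_csSup (hbdd (prefixList ω k)) ⟨ω, mem_cyl_prefixList ω k, rfl⟩
    exact this.trans_lt (lt_add_of_pos_right _ hδ)
  let gm : ℕ → Path X → ℝ := fun m ω => G (prefixList ω m)
  have hanti : Antitone gm := antitone_nat_of_succ_le fun m ω => by
    have hsub : cyl (prefixList ω (m + 1)) ⊆ cyl (prefixList ω m) := by
      rw [prefixList_succ]
      exact cyl_append_subset _ _
    have hne : (g '' cyl (prefixList ω (m + 1))).Nonempty :=
      ⟨g ω, ω, mem_cyl_prefixList ω (m + 1), rfl⟩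
    exact add_le_add_left (csSup_le_csSup (hbdd (prefixList ω m)) hne (Set.image_mono hsub)) δ
  have hprice : ∀ m, hedgePrice Q f s - δ ≤ hedgePrice Q (gm m) s := fun m => by
    refine (hKU {x | f (ψ x) < gm m (ψ x)}
      (isOpen_lt hfψ ((continuous_comp_prefixList G m).comp hψ)) fun x hx => ?_).le.trans
      (hedgePrice_mono (fun ω => hGC _) fun ω => ?_)
    · have h := hgG (ψ x) m
      rwa [hg_def, Set.indicator_of_mem (Set.mem_image_of_mem ψ hx)] at h
    · refine Set.indicator_apply_le' ?_ fun _ => hG0 _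
      rintro ⟨x, hx, rfl⟩
      exact le_of_lt hx
  let V : List X → ℝ := fun t => ⨅ m, hedgePrice Q (gm m) t
  have hVG : ∀ t, V t ≤ G t := fun t => by
    refine (ciInf_le ⟨0, ?_⟩ t.length).trans (hedgePrice_le_const (hG0 t) fun ω hω => ?_)
    · rintro _ ⟨m, rfl⟩
      exact hedgePrice_nonneg Q _ t
    · exact le_of_eq (congrArg G (mem_cyl.1 hω))
  obtain ⟨p, hp, hpV⟩ := hagree.exists_compatible
    (iInf_hedgePrice_le_step Q (g := gm) (fun m ω => hGC _) hanti)
  refine ⟨p, hp, ?_⟩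
  set μ := Pm p s
  have hμ : IsTreeMeasure p s μ := hPm p s
  have := hμ.1
  have hfint : Integrable f μ := Integrable.of_mem_Icc 0 C hf.aemeasurable
    (Eventually.of_forall fun ω => ⟨hf0 ω, hfC ω⟩)
  have hlow : ∀ k ≥ s.length, hedgePrice Q f s - δ ≤ ∫ ω, G (prefixList ω k) ∂μ := fun k hk => by
    have h := hμ.integral_prefixList_le (M := fun t => -V t) (fun t => by
      simp only [mul_neg, Finset.sum_neg_distrib]
      exact neg_le_neg (hpV t)) hk
    rw [integral_neg] at h
    exact (le_ciInf hprice).trans ((neg_le_neg_iff.1 h).trans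
      (integral_mono (integrable_comp_prefixList μ V k) (integrable_comp_prefixList μ G k)
        fun ω => hVG _))
  have hev : ∀ ω, ∀ᶠ k in atTop, G (prefixList ω k) ≤ f ω + 2 * δ := fun ω => by
    let L : Set (Path X) := ψ '' (K ∩ {x | f ω + δ ≤ f (ψ x)})
    have hL : IsClosed L :=
      ((hK.inter_right (isClosed_le continuous_const hfψ)).image hψ).isClosed
    have hω : ω ∈ Lᶜ := by
      rintro ⟨x, ⟨-, hx⟩, rfl⟩
      simp only [Set.mem_ofPred_eq] at hx
      linarith
    obtain ⟨k, hk⟩ := exists_cyl_subset hL.isOpen_compl hω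
    filter_upwards [eventually_ge_atTop k] with n hn
    refine (hanti hn ω).trans ?_
    have : sSup (g '' cyl (prefixList ω k)) ≤ f ω + δ := by
      refine csSup_le ⟨_, ω, mem_cyl_prefixList ω _, rfl⟩ ?_
      rintro _ ⟨ω', hω', rfl⟩
      refine Set.indicator_apply_le' ?_ fun _ => add_nonneg (hf0 ω) hδ.le
      rintro ⟨x, hx, rfl⟩
      by_contra! hlt
      exact hk hω' ⟨x, ⟨hx, hlt.le⟩, rfl⟩
    change sSup (g '' cyl (prefixList ω k)) + δ ≤ _
    linarith
  have hlim : Tendsto (fun k => ∫ ω, max (G (prefixList ω k)) (f ω + 2 * δ) ∂μ) atTop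
      (𝓝 (∫ ω, (f ω + 2 * δ) ∂μ)) := by
    refine tendsto_integral_of_dominated_convergence (fun _ => C + 2 * δ)
      (fun k => ((measurable_comp_prefixList G k).max
        (hf.add_const (2 * δ))).aestronglyMeasurable) (integrable_const _)
      (fun k => Eventually.of_forall fun ω => ?_) (Eventually.of_forall fun ω => ?_)
    · rw [Real.norm_of_nonneg (le_max_of_le_left (hG0 _))]
      exact max_le ((hGC _).trans (by linarith)) (by linarith [hfC ω])
    · refine tendsto_const_nhds.congr' ?_
      filter_upwards [hev ω] with k hk
      rw [max_eq_right hk]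
  have hfin : hedgePrice Q f s - δ ≤ ∫ ω, (f ω + 2 * δ) ∂μ := by
    refine ge_of_tendsto hlim ?_
    filter_upwards [eventually_ge_atTop s.length] with k hk
    exact (hlow k hk).trans (integral_mono (integrable_comp_prefixList μ G k)
      ((integrable_comp_prefixList μ G k).sup (hfint.add (integrable_const _)))
      fun ω => le_max_left _ _)
  rw [integral_add hfint (integrable_const _)] at hfin
  simp only [integral_const, probReal_univ, one_smul] at hfin
  linarith

/-! ### Comparison of the two upper expectations -/

lemma upperInt_le_gtBB {P : ImpreciseTree X} {Q : UpperExpTree X} (hagree : Agree P Q)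
    {p : PreciseTree X} (hp : Compatible p P) {s : List X} {μ : Measure (Path X)}
    (hμ : IsTreeMeasure p s μ) {f g : Path X → EReal} (hg : Measurable g) {B : ℝ}
    (hB : ∀ ω, (B : EReal) ≤ g ω) (hfg : ∀ ω, f ω ≤ g ω) : upperInt μ f ≤ gtBB Q g s := by
  have := hμ.1
  have hle : upperInt μ f ≤ integralE μ g := sInf_le ⟨g, hg, ⟨B, hB⟩, hfg, rfl⟩
  refine hle.trans (integralE_le hg hB fun c => ?_)
  refine le_trans (le_sInf ?_)
    (le_iSup (fun c : ℝ => gtG Q (fun ω => (g ω ⊓ (c : EReal)).toReal) s) c)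
  rintro _ ⟨M, hM, ⟨b, hb⟩, hlim, rfl⟩
  refine EReal.coe_le_coe_iff.2 (hμ.integral_le_of_superhedges
    (hagree.isSupermart_sum_le hp hM) (B := min b (min B c))
    (fun t => (min_le_left _ _).trans (hb t))
    (integrable_toReal_inf μ hg hB c)
    (fun ω => (min_le_right _ _).trans (min_le_toReal_inf (hB ω) c)) fun ω hω => ?_)
  exact coe_le_liminf_iff.1 (hlim ω hω)

lemma gtG_add_const_le_hedgePrice (Q : UpperExpTree X) {f : Path X → ℝ} {C : ℝ}
    (hf : ∀ ω, f ω ≤ C) (b : ℝ) (s : List X) :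
    gtG Q (fun ω => f ω + b) s ≤ ((hedgePrice Q f s + b : ℝ) : EReal) := by
  refine EReal.le_of_forall_lt_iff_le.1 fun a ha => ?_
  have ha' : hedgePrice Q f s < a - b := by
    have := EReal.coe_lt_coe_iff.1 ha
    linarith
  obtain ⟨M, hM, hM0, hsup, hlt⟩ := exists_superhedge hf ha'
  have hle : gtG Q (fun ω => f ω + b) s ≤ ((M s + b : ℝ) : EReal) := by
    refine sInf_le ⟨fun t => M t + b, hM.add (isSupermart_const Q b), ⟨b, fun t => ?_⟩,
      fun ω hω => coe_le_liminf_iff.2 fun r hr => ?_, rfl⟩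
    · linarith [hM0 t]
    · filter_upwards [hsup ω hω (r - b) (by linarith)] with k hk
      linarith
  exact hle.trans (EReal.coe_le_coe_iff.2 (by linarith))

lemma gtBB_le_muUE {P : ImpreciseTree X} {Q : UpperExpTree X}
    {Pm : PreciseTree X → List X → Measure (Path X)}
    (hPm : ∀ (p : PreciseTree X) (s : List X), IsTreeMeasure p s (Pm p s)) (hagree : Agree P Q)
    {f : Path X → EReal} (hf : Measurable f) {B : ℝ} (hB : ∀ ω, (B : EReal) ≤ f ω) (s : List X) :
    gtBB Q f s ≤ muUE Pm P f s := by
  refine iSup_le fun c => ?_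
  set h : Path X → ℝ := fun ω => (f ω ⊓ (c : EReal)).toReal
  set b := min B c
  have hbc : b ≤ c := min_le_right _ _
  have hbh : ∀ ω, b ≤ h ω := fun ω => min_le_toReal_inf (hB ω) c
  have hhc : ∀ ω, h ω ≤ c := fun ω => toReal_inf_le (hB ω) c
  have hprice : gtG Q h s ≤ ((hedgePrice Q (fun ω => h ω - b) s + b : ℝ) : EReal) := by
    simpa using gtG_add_const_le_hedgePrice Q (f := fun ω => h ω - b) (C := c - b)
      (fun ω => sub_le_sub_right (hhc ω) b) b s
  refine hprice.trans (EReal.ge_of_forall_gt_iff_ge.1 fun a ha => ?_)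
  have hε : 0 < hedgePrice Q (fun ω => h ω - b) s + b - a := sub_pos.2 (EReal.coe_lt_coe_iff.1 ha)
  obtain ⟨p, hp, hle⟩ := exists_compatible_hedgePrice_le hPm hagree (f := fun ω => h ω - b)
    ((measurable_toReal_inf hf c).sub_const b) (sub_nonneg.2 hbc) (fun ω => sub_nonneg.2 (hbh ω))
    (fun ω => sub_le_sub_right (hhc ω) b) s hε
  have := (hPm p s).1
  have hint : Integrable h (Pm p s) := integrable_toReal_inf _ hf hB c
  rw [integral_sub hint (integrable_const _)] at hle
  simp only [integral_const, probReal_univ, one_smul] at hle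
  have hup : ((∫ ω, h ω ∂(Pm p s) : ℝ) : EReal) ≤ upperInt (Pm p s) f := by
    refine le_sInf ?_
    rintro _ ⟨g, -, -, hfg, rfl⟩
    refine coe_integral_le_integralE hint fun ω => ?_
    rw [coe_toReal_inf (hB ω)]
    exact inf_le_left.trans (hfg ω)
  exact (EReal.coe_le_coe_iff.2 (by linarith)).trans (hup.trans
    (le_iSup₂ (f := fun (p : PreciseTree X) (_ : Compatible p P) => upperInt (Pm p s) f) p hp))

theorem stmt13 (P : ImpreciseTree X) (Q : UpperExpTree X)
    (Pm : PreciseTree X → List X → Measure (Path X))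
    (hPm : ∀ (p : PreciseTree X) (s : List X), IsTreeMeasure p s (Pm p s))
    (hagree : Agree P Q) (s : List X) (f : Path X → EReal)
    (hmeas : Measurable f) (hbb : ∃ B : ℝ, ∀ ω, (B : EReal) ≤ f ω) :
    muUE Pm P f s = gtUE Q f s := by
  obtain ⟨B, hB⟩ := hbb
  refine le_antisymm (iSup₂_le fun p hp => le_iInf fun c => ?_) ((iInf_le _ B).trans ?_)
  · exact upperInt_le_gtBB hagree hp (hPm p s) (hmeas.sup measurable_const)
      (fun ω => (hB ω).trans le_sup_left) fun ω => le_sup_left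
  · simp only [sup_of_le_left (hB _)]
    exact gtBB_le_muUE hPm hagree hmeas hB s

end UEPaper
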